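/- Let a, b be positive integers and suppose V ∈ Inc^ℓ(a × b) satisfies Frame(V) = Frame(Ψ(V)), where Ψ denotes K-promotion. Then the entries of V increase consecutively around the frame: for every pair of horizontally adjacent boxes 𝖻, 𝖻^→ in the first row or in the last row, V(𝖻^→) = V(𝖻) + 1, and for every pair of vertically adjacent boxes 𝖻, 𝖻^↓ in the first column or in the last column, V(𝖻^↓) = V(𝖻) + 1. -/

import Mathlib

open scoped Classical

/-- Two boxes of the `a × b` grid are adjacent if they share an edge. -/
def Adj {a b : ℕ} (x y : Fin a × Fin b) : Prop :=
  (x.1 = y.1 ∧ ((x.2 : ℕ) + 1 = (y.2 : ℕ) ∨ (y.2 : ℕ) + 1 = (x.2 : ℕ))) ∨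
  (x.2 = y.2 ∧ ((x.1 : ℕ) + 1 = (y.1 : ℕ) ∨ (y.1 : ℕ) + 1 = (x.1 : ℕ)))

/-- `IncTab a b q T` says `T` is an increasing tableau of shape `a × b`
(rows strictly increase left-to-right, columns strictly increase top-to-bottom)
with positive entries, all at most `q`; i.e. `T ∈ Inc^q(a × b)`. -/
def IncTab (a b q : ℕ) (T : Fin a × Fin b → ℕ) : Prop :=
  (∀ x, 1 ≤ T x ∧ T x ≤ q) ∧
  (∀ (i : Fin a) (j₁ j₂ : Fin b), j₁ < j₂ → T (i, j₁) < T (i, j₂)) ∧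
  (∀ (i₁ i₂ : Fin a) (j : Fin b), i₁ < i₂ → T (i₁, j) < T (i₂, j))

/-- In the filling `f`, boxes `x` and `y` lie in a common edge-connected
component (short ribbon) of the set of boxes labeled `1` or `t`. -/
def SameRibbon {a b : ℕ} (t : ℕ) (f : Fin a × Fin b → ℕ) (x y : Fin a × Fin b) : Prop :=
  Relation.ReflTransGen
    (fun u v => Adj u v ∧ (f u = 1 ∨ f u = t) ∧ (f v = 1 ∨ f v = t)) x y

/-- One step of the K-promotion algorithm at value `t`: in every nontrivial
edge-connected component of the set of boxes labeled `1` or `t`, the labels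
`1` and `t` are swapped; boxes in trivial components are unchanged. -/
noncomputable def BKstep {a b : ℕ} (t : ℕ) (f : Fin a × Fin b → ℕ) :
    Fin a × Fin b → ℕ := fun x =>
  if ∃ y, y ≠ x ∧ SameRibbon t f x y then
    (if f x = 1 then t else if f x = t then 1 else f x)
  else f x

/-- The intermediate filling obtained from `f` after performing the swap steps
for the values `2, 3, …, t - 1` (so `sweepUpTo t f` is the filling in force
when the step for value `t` is about to be performed). -/
noncomputable def sweepUpTo {a b : ℕ} (t : ℕ) (f : Fin a × Fin b → ℕ) :
    Fin a × Fin b → ℕ :=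
  (List.range' 2 (t - 2)).foldl (fun g s => BKstep s g) f

/-- K-promotion `Ψ : Inc^q(a × b) → Inc^q(a × b)`: perform the swap steps for
`t = 2, …, q`, then decrement every entry by `1`, replacing a resulting `0`
by `q`. -/
noncomputable def KPro {a b : ℕ} (q : ℕ) (T : Fin a × Fin b → ℕ) :
    Fin a × Fin b → ℕ := fun x =>
  if sweepUpTo (q + 1) T x = 1 then q else sweepUpTo (q + 1) T x - 1

/-- The Ψ-orbit of `T` under K-promotion. -/
noncomputable def PsiOrbit {a b : ℕ} (q : ℕ) (T : Fin a × Fin b → ℕ) :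
    Set (Fin a × Fin b → ℕ) :=
  {U | ∃ n : ℕ, (KPro q)^[n] T = U}

/-- The pair `{x, y}` of adjacent boxes belongs to the flow path of `V`:
at the step for some value `t ∈ {2, …, q}`, both boxes carry label `1` or `t`,
so they form part of a common nontrivial short ribbon whose labels are swapped. -/
def FlowPath {a b : ℕ} (q : ℕ) (V : Fin a × Fin b → ℕ) (x y : Fin a × Fin b) : Prop :=
  Adj x y ∧ ∃ t, 2 ≤ t ∧ t ≤ q ∧
    (sweepUpTo t V x = 1 ∨ sweepUpTo t V x = t) ∧
    (sweepUpTo t V y = 1 ∨ sweepUpTo t V y = t)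

/-- The stream-bed of `V`: boxes appearing in some pair of the flow path. -/
def StreamBed {a b : ℕ} (q : ℕ) (V : Fin a × Fin b → ℕ) (x : Fin a × Fin b) : Prop :=
  ∃ y, FlowPath q V x y ∨ FlowPath q V y x

/-- The box `x` lies in the frame of the `a × b` grid (first or last row,
or first or last column). -/
def InFrame {a b : ℕ} (x : Fin a × Fin b) : Prop :=
  (x.1 : ℕ) = 0 ∨ (x.1 : ℕ) = a - 1 ∨ (x.2 : ℕ) = 0 ∨ (x.2 : ℕ) = b - 1

/-- `Frame(V) = Frame(W)`: the fillings agree on all frame boxes. -/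
def FrameEq {a b : ℕ} (V W : Fin a × Fin b → ℕ) : Prop :=
  ∀ x, InFrame x → V x = W x

/-- The minimal tableau `M_{a×b}`, with entries `M(i,j) = i + j - 1`
(in 1-based coordinates; here coordinates are 0-based). -/
def MinTab (a b : ℕ) : Fin a × Fin b → ℕ := fun x => (x.1 : ℕ) + (x.2 : ℕ) + 1

structure SweepInv {a b : ℕ} (V f : Fin a × Fin b → ℕ) (t : ℕ) : Prop where
  A : ∀ x, t ≤ V x → f x = V x
  B : ∀ x, V x < t → f x < t
  P : ∀ x, 1 ≤ f x
  C : ∀ x y, Adj x y → f x = 1 → f y = 1 → False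
  D : ∀ x, f x ≠ 1 → f x ≠ V x → ∃ y, Adj x y ∧ V y = f x
  E : ∀ x, 2 ≤ V x → f x ≠ V x → ∃ y, Adj x y ∧ V y < V x ∧ f y = V x

theorem Adj.symm' {a b : ℕ} {x y : Fin a × Fin b} (h : Adj x y) : Adj y x := by
  unfold Adj at *
  rcases h with ⟨h, h'⟩ | ⟨h, h'⟩
  · exact Or.inl ⟨h.symm, h'.symm⟩
  · exact Or.inr ⟨h.symm, h'.symm⟩

theorem Adj.ne' {a b : ℕ} {x y : Fin a × Fin b} (h : Adj x y) : y ≠ x := by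
  rintro rfl
  unfold Adj at h
  omega

theorem IncTab.adj_ne {a b q : ℕ} {V : Fin a × Fin b → ℕ} (hV : IncTab a b q V)
    {x y : Fin a × Fin b} (h : Adj x y) : V x ≠ V y := by
  obtain ⟨-, h1, h2⟩ := hV
  obtain ⟨i, j⟩ := x
  obtain ⟨k, l⟩ := y
  rcases h with ⟨h, h' | h'⟩ | ⟨h, h' | h'⟩ <;> simp only at h h' <;> subst h
  · exact (h1 _ j l (Fin.lt_def.2 (by omega))).ne
  · exact (h1 _ l j (Fin.lt_def.2 (by omega))).ne'
  · exact (h2 i k _ (Fin.lt_def.2 (by omega))).ne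
  · exact (h2 k i _ (Fin.lt_def.2 (by omega))).ne'

theorem nontriv_iff {a b : ℕ} (t : ℕ) (f : Fin a × Fin b → ℕ) (x : Fin a × Fin b) :
    (∃ y, y ≠ x ∧ SameRibbon t f x y) ↔
      ∃ y, Adj x y ∧ (f x = 1 ∨ f x = t) ∧ (f y = 1 ∨ f y = t) := by
  constructor
  · rintro ⟨y, hy, h⟩
    rcases Relation.ReflTransGen.cases_head h with h | ⟨z, hz, -⟩
    · exact absurd h.symm hy
    · exact ⟨z, hz⟩
  · rintro ⟨y, h⟩
    exact ⟨y, h.1.ne', Relation.ReflTransGen.single h⟩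

theorem SweepInv.step {a b q : ℕ} {V f : Fin a × Fin b → ℕ} (hV : IncTab a b q V) {t : ℕ}
    (ht : 2 ≤ t) (h : SweepInv V f t) : SweepInv V (BKstep t f) (t + 1) := by
  have hT : ∀ x, f x = t → V x = t := by
    intro x hx
    by_contra hne
    rcases lt_or_ge (V x) t with h1 | h1
    · have := h.B x h1; omega
    · have := h.A x h1; omega
  have s1 : ∀ x y, Adj x y → f x = 1 → f y = t → BKstep t f x = t := by
    intro x y hxy hx hy
    have : ∃ y, y ≠ x ∧ SameRibbon t f x y :=
      (nontriv_iff t f x).2 ⟨y, hxy, Or.inl hx, Or.inr hy⟩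
    simp [BKstep, this, hx]
  have s2 : ∀ x y, Adj x y → f x = t → f y = 1 → BKstep t f x = 1 := by
    intro x y hxy hx hy
    have : ∃ y, y ≠ x ∧ SameRibbon t f x y :=
      (nontriv_iff t f x).2 ⟨y, hxy, Or.inr hx, Or.inl hy⟩
    simp only [BKstep, this, hx, if_true]
    split_ifs <;> omega
  have s3 : ∀ x, BKstep t f x = f x ∨
      (f x = 1 ∧ BKstep t f x = t ∧ ∃ y, Adj x y ∧ f y = t) ∨
      (f x = t ∧ BKstep t f x = 1 ∧ ∃ y, Adj x y ∧ f y = 1) := by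
    intro x
    by_cases hn : ∃ y, y ≠ x ∧ SameRibbon t f x y
    · obtain ⟨y, hxy, hx, hy⟩ := (nontriv_iff t f x).1 hn
      rcases hx with hx | hx <;> rcases hy with hy | hy
      · exact (h.C x y hxy hx hy).elim
      · exact Or.inr (Or.inl ⟨hx, s1 x y hxy hx hy, y, hxy, hy⟩)
      · exact Or.inr (Or.inr ⟨hx, s2 x y hxy hx hy, y, hxy, hy⟩)
      · exact (hV.adj_ne hxy ((hT x hx).trans (hT y hy).symm)).elim
    · left
      simp only [BKstep, if_neg hn]
  have hA1 : ∀ x, f x = 1 → V x < t := by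
    intro x hx
    by_contra hc
    have := h.A x (by omega)
    omega
  have stay : ∀ x, f x ≠ 1 → f x ≠ t → BKstep t f x = f x := by
    intro x h1 h2
    rcases s3 x with e | ⟨e, -⟩ | ⟨e, -⟩
    · exact e
    · exact absurd e h1
    · exact absurd e h2
  refine ⟨?_, ?_, ?_, ?_, ?_, ?_⟩
  · intro x hx
    have := h.A x (by omega)
    rw [stay x (by omega) (by omega), this]
  · intro x hx
    rcases s3 x with e | ⟨e, e', -⟩ | ⟨e, e', -⟩
    · rcases Nat.lt_or_ge (V x) t with h1 | h1
      · have := h.B x h1; omega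
      · have := h.A x h1; omega
    · omega
    · omega
  · intro x
    have := h.P x
    rcases s3 x with e | ⟨e, e', -⟩ | ⟨e, e', -⟩ <;> omega
  · intro x y hxy hx hy
    rcases s3 x with e | ⟨e, e', -⟩ | ⟨e, e', -⟩
    · rcases s3 y with g | ⟨g, g', -⟩ | ⟨g, g', -⟩
      · exact h.C x y hxy (by omega) (by omega)
      · omega
      · have := s1 x y hxy (by omega) g
        omega
    · omega
    · rcases s3 y with g | ⟨g, g', -⟩ | ⟨g, g', -⟩
      · have := s1 y x hxy.symm' (by omega) e
        omega
      · omega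
      · exact hV.adj_ne hxy ((hT x e).trans (hT y g).symm)
  · intro x h1 h2
    rcases s3 x with e | ⟨e, e', y, hxy, hy⟩ | ⟨e, e', -⟩
    · rw [e] at h1 h2 ⊢
      exact h.D x h1 h2
    · exact ⟨y, hxy, by rw [e', hT y hy]⟩
    · exact absurd e' h1
  · intro x h1 h2
    by_cases hx : f x = V x
    · rcases s3 x with e | ⟨e, e', -⟩ | ⟨e, e', y, hxy, hy⟩
      · exact absurd (e.trans hx) h2
      · omega
      · have hv := hT x e
        have := hA1 y hy
        exact ⟨y, hxy, by omega, by rw [s1 y x hxy.symm' hy e, hv]⟩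
    · obtain ⟨y, hxy, hlt, hy⟩ := h.E x h1 hx
      refine ⟨y, hxy, hlt, ?_⟩
      rw [stay y (by omega) ?_, hy]
      intro hc
      exact hx (h.A x (by omega))

theorem SweepInv.base {a b q : ℕ} {V : Fin a × Fin b → ℕ} (hV : IncTab a b q V) :
    SweepInv V V 2 := by
  refine ⟨fun _ _ => rfl, fun _ h => h, fun x => (hV.1 x).1, ?_, ?_, ?_⟩
  · intro x y hxy hx hy
    exact hV.adj_ne hxy (hx.trans hy.symm)
  · intro x _ h
    exact absurd rfl h
  · intro x _ h
    exact absurd rfl h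

theorem SweepInv.all {a b q : ℕ} {V : Fin a × Fin b → ℕ} (hV : IncTab a b q V) (n : ℕ) :
    SweepInv V (sweepUpTo (n + 2) V) (n + 2) := by
  induction n with
  | zero => simpa [sweepUpTo] using SweepInv.base hV
  | succ n ih =>
    have e : sweepUpTo (n + 1 + 2) V = BKstep (n + 2) (sweepUpTo (n + 2) V) := by
      simp [sweepUpTo, List.range'_concat, add_comm]
    rw [e]
    exact SweepInv.step hV (by omega) ih

/-- Suppose `V ∈ Inc^ℓ(a × b)` satisfies `Frame(V) = Frame(Ψ(V))`. Then the
entries of `V` increase consecutively around the frame: horizontally adjacent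
boxes in the first or last row differ by `1`, and vertically adjacent boxes
in the first or last column differ by `1`. -/
theorem frame_fixed_consecutive (a b : ℕ) (ha : 0 < a) (hb : 0 < b)
    (ℓ : ℕ) (V : Fin a × Fin b → ℕ) (hV : IncTab a b ℓ V)
    (hframe : FrameEq V (KPro ℓ V)) :
    (∀ (i : Fin a) (j : Fin b) (h : (j : ℕ) + 1 < b),
      ((i : ℕ) = 0 ∨ (i : ℕ) = a - 1) →
        V (i, ⟨(j : ℕ) + 1, h⟩) = V (i, j) + 1) ∧
    (∀ (i : Fin a) (j : Fin b) (h : (i : ℕ) + 1 < a),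
      ((j : ℕ) = 0 ∨ (j : ℕ) = b - 1) →
        V (⟨(i : ℕ) + 1, h⟩, j) = V (i, j) + 1) := by
  have hl : 1 ≤ ℓ := by
    have := hV.1 (⟨0, ha⟩, ⟨0, hb⟩)
    omega
  have inv : SweepInv V (sweepUpTo (ℓ + 1) V) (ℓ + 1) := by
    have := SweepInv.all hV (ℓ - 1)
    rwa [show ℓ - 1 + 2 = ℓ + 1 by omega] at this
  -- forward: a frame box with entry below the bound has a neighbour one larger
  have fwd : ∀ x, InFrame x → V x < ℓ → ∃ y, Adj x y ∧ V y = V x + 1 := by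
    intro x hx hlt
    have h := hframe x hx
    have hp := inv.P x
    have hp' := (hV.1 x).1
    unfold KPro at h
    split_ifs at h with h1
    · omega
    · obtain ⟨y, hy, e⟩ := inv.D x h1 (by omega)
      exact ⟨y, hy, by omega⟩
  have bwd : ∀ x, InFrame x → 2 ≤ V x →
      ∃ y, Adj x y ∧ V y < V x ∧ (InFrame y → V x = V y + 1) := by
    intro x hx h2
    have h := hframe x hx
    have hne : sweepUpTo (ℓ + 1) V x ≠ V x := by
      intro e
      unfold KPro at h
      split_ifs at h with h1 <;> omega
    obtain ⟨y, hxy, hlt, hy⟩ := inv.E x h2 hne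
    refine ⟨y, hxy, hlt, fun hf => ?_⟩
    have h' := hframe y hf
    unfold KPro at h'
    split_ifs at h' <;> omega
  obtain ⟨hb1, hrow, hcol⟩ := hV
  constructor
  · intro i j h hi
    have hlt : V (i, j) < V (i, ⟨(j : ℕ) + 1, h⟩) := hrow i _ _ (Fin.lt_def.2 (by simp))
    have u1 := hb1 (i, j)
    have u2 := hb1 (i, ⟨(j : ℕ) + 1, h⟩)
    rcases hi with hi | hi
    · obtain ⟨⟨k, l⟩, hadj, hl', himp⟩ := bwd (i, ⟨(j : ℕ) + 1, h⟩) (Or.inl hi) (by omega)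
      rcases hadj with ⟨e, e' | e'⟩ | ⟨e, e' | e'⟩ <;> simp only at e e' <;> subst e
      · have := hrow i ⟨(j : ℕ) + 1, h⟩ l (Fin.lt_def.2 (by simp only; omega))
        omega
      · have : l = j := Fin.ext (by omega)
        subst this
        exact himp (Or.inl hi)
      · have := hcol i k ⟨(j : ℕ) + 1, h⟩ (Fin.lt_def.2 (by omega))
        omega
      · omega
    · obtain ⟨⟨k, l⟩, hadj, hl'⟩ := fwd (i, j) (Or.inr (Or.inl hi)) (by omega)
      rcases hadj with ⟨e, e' | e'⟩ | ⟨e, e' | e'⟩ <;> simp only at e e' <;> subst e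
      · have : l = ⟨(j : ℕ) + 1, h⟩ := Fin.ext (by simp only; omega)
        subst this
        exact hl'
      · have := hrow i l j (Fin.lt_def.2 (by omega))
        omega
      · have := k.2
        omega
      · have := hcol k i j (Fin.lt_def.2 (by omega))
        omega
  · intro i j h hj
    have hlt : V (i, j) < V (⟨(i : ℕ) + 1, h⟩, j) := hcol _ _ j (Fin.lt_def.2 (by simp))
    have u1 := hb1 (i, j)
    have u2 := hb1 (⟨(i : ℕ) + 1, h⟩, j)
    rcases hj with hj | hj
    · obtain ⟨⟨k, l⟩, hadj, hl', himp⟩ :=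
        bwd (⟨(i : ℕ) + 1, h⟩, j) (Or.inr (Or.inr (Or.inl hj))) (by omega)
      rcases hadj with ⟨e, e' | e'⟩ | ⟨e, e' | e'⟩ <;> simp only at e e' <;> subst e
      · have := hrow ⟨(i : ℕ) + 1, h⟩ j l (Fin.lt_def.2 (by omega))
        omega
      · omega
      · have := hcol ⟨(i : ℕ) + 1, h⟩ k j (Fin.lt_def.2 (by simp only; omega))
        omega
      · have : k = i := Fin.ext (by omega)
        subst this
        exact himp (Or.inr (Or.inr (Or.inl hj)))
    · obtain ⟨⟨k, l⟩, hadj, hl'⟩ := fwd (i, j) (Or.inr (Or.inr (Or.inr hj))) (by omega)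
      rcases hadj with ⟨e, e' | e'⟩ | ⟨e, e' | e'⟩ <;> simp only at e e' <;> subst e
      · have := l.2
        omega
      · have := hrow i l j (Fin.lt_def.2 (by omega))
        omega
      · have : k = ⟨(i : ℕ) + 1, h⟩ := Fin.ext (by simp only; omega)
        subst this
        exact hl'
      · have := hcol k i j (Fin.lt_def.2 (by omega))
        omega
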